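/- For any complex numbers c₁, c₂, the formal power series quotient ℂ[[x,y]]/(∂f/∂x, ∂f/∂y) for f = x³ + y¹⁰ + c₁·x·y⁷ + c₂·x·y⁸ is a ℂ-vector space of dimension 18. In particular, the Milnor number at the origin is constant equal to 18 along this deformation (the E₁₈ μ-constant deformation). -/

import Mathlib

open MvPolynomial

namespace MvPowerSeries

open Finsupp (single weight)

section Filtration

variable {σ K : Type*} [CommRing K]

/-- The ideal of power series all of whose terms have weight at least `n`. -/
def weightIdeal (K : Type*) [CommRing K] (w : σ → ℕ) (n : ℕ) : Ideal (MvPowerSeries σ K) where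
  carrier := {f | (n : ℕ∞) ≤ f.weightedOrder w}
  add_mem' ha hb := (le_min ha hb).trans (min_weightedOrder_le_add w)
  zero_mem' := by simp
  smul_mem' c _ hf := le_trans (le_add_left hf) (le_weightedOrder_mul w (f := c))

variable {w : σ → ℕ} {f g : MvPowerSeries σ K} {m n : ℕ}

theorem mem_weightIdeal_iff_le_weightedOrder :
    f ∈ weightIdeal K w n ↔ (n : ℕ∞) ≤ f.weightedOrder w := Iff.rfl

theorem mem_weightIdeal_iff :
    f ∈ weightIdeal K w n ↔ ∀ d, weight w d < n → coeff d f = 0 :=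
  ⟨fun h _ hd ↦ coeff_eq_zero_of_lt_weightedOrder w (lt_of_lt_of_le (by exact_mod_cast hd) h),
    fun h ↦ nat_le_weightedOrder w h⟩

theorem weightIdeal_anti (h : m ≤ n) : weightIdeal K w n ≤ weightIdeal K w m :=
  fun _ hf ↦ le_trans (by exact_mod_cast h) (mem_weightIdeal_iff_le_weightedOrder.1 hf)

theorem mul_mem_weightIdeal (hf : f ∈ weightIdeal K w m) (hg : g ∈ weightIdeal K w n) :
    f * g ∈ weightIdeal K w (m + n) := by
  rw [mem_weightIdeal_iff_le_weightedOrder] at *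
  push_cast
  exact (add_le_add hf hg).trans (le_weightedOrder_mul w)

theorem eq_zero_of_forall_mem_weightIdeal (h : ∀ n, f ∈ weightIdeal K w n) : f = 0 := by
  ext d
  exact mem_weightIdeal_iff.1 (h (weight w d + 1)) d (Nat.lt_succ_self _)

theorem monomial_mem_weightIdeal (d : σ →₀ ℕ) (a : K) (h : n ≤ weight w d) :
    monomial d a ∈ weightIdeal K w n := by
  classical
  rw [mem_weightIdeal_iff]
  intro e he
  rw [coeff_monomial, if_neg]
  rintro rfl
  omega

/-- A perturbation of the identity by a linear map which raises weights is bijective. -/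
theorem bijective_id_add_of_raises_weight
    (T : MvPowerSeries σ K →ₗ[K] MvPowerSeries σ K)
    (hT : ∀ n, ∀ f ∈ weightIdeal K w n, T f ∈ weightIdeal K w (n + 1)) :
    Function.Bijective ((LinearMap.id : MvPowerSeries σ K →ₗ[K] MvPowerSeries σ K) + T) := by
  constructor
  · rw [injective_iff_map_eq_zero]
    intro f hf
    have hf' : f = -T f := eq_neg_of_add_eq_zero_left hf
    refine eq_zero_of_forall_mem_weightIdeal (w := w) fun n ↦ ?_
    induction n with
    | zero => rw [mem_weightIdeal_iff]; intro d hd; omega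
    | succ n ih => rw [hf']; exact neg_mem (hT n f ih)
  · intro h
    let s : ℕ → MvPowerSeries σ K := fun n ↦ (fun f ↦ h - T f)^[n] 0
    have hs (n) : s (n + 1) = h - T (s n) := Function.iterate_succ_apply' _ _ _
    have hstep (n) : s (n + 1) - s n ∈ weightIdeal K w n := by
      induction n with
      | zero => rw [mem_weightIdeal_iff]; intro d hd; omega
      | succ n ih =>
        have : s (n + 1 + 1) - s (n + 1) = -T (s (n + 1) - s n) := by
          rw [hs (n + 1), map_sub]
          nth_rewrite 2 [hs n]
          abel
        rw [this]
        exact neg_mem (hT n _ ih)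
    have hcauchy (n k) : s (n + k) - s n ∈ weightIdeal K w n := by
      induction k with
      | zero => simp
      | succ k ih =>
        have := add_mem (weightIdeal_anti (Nat.le_add_right n k) (hstep (n + k))) ih
        simpa [← add_assoc] using this
    let f : MvPowerSeries σ K := fun d ↦ coeff d (s (weight w d + 1))
    have hlim (n) : f - s n ∈ weightIdeal K w n := by
      rw [mem_weightIdeal_iff]
      intro d hd
      obtain ⟨k, rfl⟩ := Nat.exists_eq_add_of_le (Nat.succ_le_of_lt hd)
      have := mem_weightIdeal_iff.1 (hcauchy (weight w d + 1) k) d (Nat.lt_succ_self _)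
      rw [map_sub, sub_eq_zero] at this ⊢
      exact this.symm
    refine ⟨f, sub_eq_zero.1 (eq_zero_of_forall_mem_weightIdeal (w := w) fun n ↦ ?_)⟩
    have : ((LinearMap.id : MvPowerSeries σ K →ₗ[K] MvPowerSeries σ K) + T) f - h = (f - s (n + 1)) + T (f - s n) := by
      rw [hs, map_sub, LinearMap.add_apply, LinearMap.id_apply]
      abel
    rw [this]
    exact add_mem (weightIdeal_anti n.le_succ (hlim _)) (weightIdeal_anti n.le_succ (hT n _ (hlim n)))

open Classical in
/-- The terms of `f / X ^ e` whose exponents are nonnegative and lie in `s`. -/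
noncomputable def divMonomialOn (e : σ →₀ ℕ) (s : Set (σ →₀ ℕ)) :
    MvPowerSeries σ K →ₗ[K] MvPowerSeries σ K where
  toFun f := fun d ↦ if d ∈ s then coeff (d + e) f else 0
  map_add' f g := by
    funext d
    change (if d ∈ s then coeff (d + e) (f + g) else 0) =
      (if d ∈ s then coeff (d + e) f else 0) + if d ∈ s then coeff (d + e) g else 0
    split_ifs <;> simp
  map_smul' c f := by
    funext d
    change (if d ∈ s then coeff (d + e) (c • f) else 0) =
      c * if d ∈ s then coeff (d + e) f else 0
    split_ifs <;> simp

open Classical in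
theorem coeff_divMonomialOn (e : σ →₀ ℕ) (s : Set (σ →₀ ℕ)) (d : σ →₀ ℕ) :
    coeff d (divMonomialOn e s f) = if d ∈ s then coeff (d + e) f else 0 := rfl

theorem divMonomialOn_mul_mem_weightIdeal (e : σ →₀ ℕ) (s : Set (σ →₀ ℕ))
    (hf : f ∈ weightIdeal K w n) (hg : g ∈ weightIdeal K w (weight w e + 1)) :
    divMonomialOn e s f * g ∈ weightIdeal K w (n + 1) := by
  have hdiv : divMonomialOn e s f ∈ weightIdeal K w (n - weight w e) := by
    rw [mem_weightIdeal_iff] at hf ⊢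
    intro d hd
    rw [coeff_divMonomialOn, hf (d + e) (by rw [map_add]; omega), ite_self]
  exact weightIdeal_anti (by omega) (mul_mem_weightIdeal hdiv hg)

end Filtration

section TwoVariables

variable {K : Type*} [CommRing K] {w : Fin 2 → ℕ} {a b : ℕ} {u v : MvPowerSeries (Fin 2) K}

/-- Weierstrass division by a perturbation of `X 0 ^ a`. -/
theorem exists_eq_add_mul_X_pow_add (hu : u ∈ weightIdeal K w (weight w (single 0 a) + 1))
    (h : MvPowerSeries (Fin 2) K) :
    ∃ r q : MvPowerSeries (Fin 2) K, (∀ d, a ≤ d 0 → coeff d r = 0) ∧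
      h = r + q * (X 0 ^ a + u) := by
  obtain ⟨f, hf⟩ := (bijective_id_add_of_raises_weight (w := w)
    ((LinearMap.mulRight K u).comp (divMonomialOn (single 0 a) Set.univ))
    fun n f hf ↦ divMonomialOn_mul_mem_weightIdeal _ _ hf hu).2 h
  refine ⟨f - divMonomialOn (single 0 a) Set.univ f * X 0 ^ a,
    divMonomialOn (single 0 a) Set.univ f, fun d hd ↦ ?_, ?_⟩
  · have hle : single 0 a ≤ d := by simpa using hd
    rw [X_pow_eq, map_sub, coeff_mul_monomial, if_pos hle, coeff_divMonomialOn,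
      if_pos (Set.mem_univ _), tsub_add_cancel_of_le hle, mul_one, sub_self]
  · rw [← hf]
    simp only [LinearMap.add_apply, LinearMap.id_apply, LinearMap.comp_apply,
      LinearMap.mulRight_apply]
    ring

/-- The coefficients of the monomials `X 0 ^ i * X 1 ^ j` with `i < a` and `j < b`. -/
noncomputable def boxCoeff (K : Type*) [CommRing K] (a b : ℕ) :
    MvPowerSeries (Fin 2) K →ₗ[K] (Fin a × Fin b → K) :=
  LinearMap.pi fun i ↦ coeff (single 0 (i.1 : ℕ) + single 1 (i.2 : ℕ))

theorem mem_ker_boxCoeff_iff {f : MvPowerSeries (Fin 2) K} :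
    f ∈ LinearMap.ker (boxCoeff K a b) ↔ ∀ d, d 0 < a → d 1 < b → coeff d f = 0 := by
  rw [LinearMap.mem_ker, funext_iff]
  constructor
  · intro h d h0 h1
    have hd : d = single 0 (d 0) + single 1 (d 1) := by
      ext i; fin_cases i <;> simp
    rw [hd]
    exact h (⟨d 0, h0⟩, ⟨d 1, h1⟩)
  · intro h i
    exact h _ (by simp) (by simp)

theorem boxCoeff_surjective : Function.Surjective (boxCoeff K a b) := by
  intro c
  refine ⟨fun d ↦ if h : d 0 < a ∧ d 1 < b then c (⟨d 0, h.1⟩, ⟨d 1, h.2⟩) else 0, ?_⟩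
  funext i
  change dite _ _ _ = c i
  simp

/-- The `K`-linear map replacing `X 0 ^ a` by `X 0 ^ a + u` and `X 1 ^ b` by `X 1 ^ b + v` in the
division of a power series by `X 0 ^ a` and `X 1 ^ b`. -/
noncomputable def perturbDivision (a b : ℕ) (u v : MvPowerSeries (Fin 2) K) :
    MvPowerSeries (Fin 2) K →ₗ[K] MvPowerSeries (Fin 2) K :=
  LinearMap.id + ((LinearMap.mulRight K u).comp (divMonomialOn (single 0 a) Set.univ) +
    (LinearMap.mulRight K v).comp (divMonomialOn (single 1 b) {d | d 0 < a}))

theorem perturbDivision_apply (f : MvPowerSeries (Fin 2) K) :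
    perturbDivision a b u v f = f + (divMonomialOn (single 0 a) Set.univ f * u +
      divMonomialOn (single 1 b) {d | d 0 < a} f * v) := rfl

theorem perturbDivision_bijective (hu : u ∈ weightIdeal K w (weight w (single 0 a) + 1))
    (hv : v ∈ weightIdeal K w (weight w (single 1 b) + 1)) :
    Function.Bijective (perturbDivision a b u v) :=
  bijective_id_add_of_raises_weight (w := w) _ fun _ _ hf ↦
    add_mem (divMonomialOn_mul_mem_weightIdeal _ _ hf hu)
      (divMonomialOn_mul_mem_weightIdeal _ _ hf hv)

theorem map_perturbDivision_ker_boxCoeff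
    (hu : u ∈ weightIdeal K w (weight w (single 0 a) + 1)) :
    (LinearMap.ker (boxCoeff K a b)).map (perturbDivision a b u v) =
      (Ideal.span {X 0 ^ a + u, X 1 ^ b + v}).restrictScalars K := by
  apply le_antisymm
  · rintro _ ⟨f, hf, rfl⟩
    rw [SetLike.mem_coe, mem_ker_boxCoeff_iff] at hf
    rw [Submodule.restrictScalars_mem, Ideal.mem_span_pair]
    refine ⟨divMonomialOn (single 0 a) Set.univ f,
      divMonomialOn (single 1 b) {d | d 0 < a} f, ?_⟩
    have key : f = divMonomialOn (single 0 a) Set.univ f * X 0 ^ a +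
        divMonomialOn (single 1 b) {d | d 0 < a} f * X 1 ^ b := by
      ext d
      simp only [X_pow_eq, map_add, coeff_mul_monomial, coeff_divMonomialOn, mul_one,
        Set.mem_univ, if_true, Set.mem_ofPred_eq, Finsupp.single_le_iff]
      by_cases h0 : a ≤ d 0
      · have hle : single 0 a ≤ d := by simpa using h0
        simp [h0, tsub_add_cancel_of_le hle]
      · by_cases h1 : b ≤ d 1
        · have hle : single 1 b ≤ d := by simpa using h1
          simp [h0, h1, tsub_add_cancel_of_le hle, not_le.1 h0]
        · simp [h0, h1, hf d (not_le.1 h0) (not_le.1 h1)]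
    rw [perturbDivision_apply]
    nth_rewrite 3 [key]
    ring
  · intro z hz
    rw [Submodule.restrictScalars_mem, Ideal.mem_span_pair] at hz
    obtain ⟨α, β, rfl⟩ := hz
    obtain ⟨r, q, hr, rfl⟩ := exists_eq_add_mul_X_pow_add hu β
    refine ⟨(α + q * (X 1 ^ b + v)) * X 0 ^ a + r * X 1 ^ b, ?_, ?_⟩
    · rw [SetLike.mem_coe, mem_ker_boxCoeff_iff]
      intro d h0 h1
      simp [X_pow_eq, coeff_mul_monomial, not_le.2 h0, not_le.2 h1]
    · generalize hγ : α + q * (X 1 ^ b + v) = γ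
      have hq : divMonomialOn (single 0 a) Set.univ (γ * X 0 ^ a + r * X 1 ^ b) = γ := by
        ext d
        rw [coeff_divMonomialOn, if_pos (Set.mem_univ _), X_pow_eq, X_pow_eq, map_add,
          coeff_add_mul_monomial, coeff_mul_monomial]
        split_ifs
        · rw [hr _ (by simp)]; simp
        · simp
      have hr' : divMonomialOn (single 1 b) {d | d 0 < a} (γ * X 0 ^ a + r * X 1 ^ b) = r := by
        ext d
        rw [coeff_divMonomialOn, X_pow_eq, X_pow_eq, map_add,
          coeff_add_mul_monomial, coeff_mul_monomial]
        by_cases h0 : d 0 < a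
        · simp [h0]
        · simp [h0, hr d (not_lt.1 h0)]
      rw [perturbDivision_apply, hq, hr', ← hγ]
      ring

/-- Perturbing `X 0 ^ a` and `X 1 ^ b` by terms of higher weight does not change the
dimension of the quotient. -/
theorem finrank_quotient_span_X_pow_add [Nontrivial K]
    (hu : u ∈ weightIdeal K w (weight w (single 0 a) + 1))
    (hv : v ∈ weightIdeal K w (weight w (single 1 b) + 1)) :
    Module.finrank K (MvPowerSeries (Fin 2) K ⧸
      Ideal.span {X 0 ^ a + u, X 1 ^ b + v}) = a * b := by
  let S : MvPowerSeries (Fin 2) K ≃ₗ[K] MvPowerSeries (Fin 2) K :=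
    LinearEquiv.ofBijective (perturbDivision a b u v) (perturbDivision_bijective hu hv)
  let e := Submodule.Quotient.equiv (LinearMap.ker (boxCoeff K a b))
    ((Ideal.span {X 0 ^ a + u, X 1 ^ b + v}).restrictScalars K) S
    (by rw [← map_perturbDivision_ker_boxCoeff hu]; rfl)
  let e' := Submodule.Quotient.restrictScalarsEquiv K
    (Ideal.span {X 0 ^ a + u, X 1 ^ b + v} : Ideal (MvPowerSeries (Fin 2) K))
  rw [← (e.trans e').finrank_eq,
    ((boxCoeff K a b).quotKerEquivOfSurjective boxCoeff_surjective).finrank_eq]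
  simp

end TwoVariables

end MvPowerSeries

/-- The Milnor number at the origin is constant equal to 18 along the E₁₈ μ-constant
deformation `f = x^3 + y^10 + c₁ x y^7 + c₂ x y^8`. -/
theorem milnor_number_E18_deformation (c₁ c₂ : ℂ) :
    Module.finrank ℂ (MvPowerSeries (Fin 2) ℂ ⧸
      Ideal.span {((pderiv 0 (X 0 ^ 3 + X 1 ^ 10 + C c₁ * X 0 * X 1 ^ 7 +
          C c₂ * X 0 * X 1 ^ 8) : MvPolynomial (Fin 2) ℂ) : MvPowerSeries (Fin 2) ℂ),
        ((pderiv 1 (X 0 ^ 3 + X 1 ^ 10 + C c₁ * X 0 * X 1 ^ 7 +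
          C c₂ * X 0 * X 1 ^ 8) : MvPolynomial (Fin 2) ℂ) : MvPowerSeries (Fin 2) ℂ)}) = 18 := by
  let u : MvPowerSeries (Fin 2) ℂ :=
    MvPowerSeries.C (c₁ / 3) * MvPowerSeries.X 1 ^ 7 +
      MvPowerSeries.C (c₂ / 3) * MvPowerSeries.X 1 ^ 8
  let v : MvPowerSeries (Fin 2) ℂ :=
    MvPowerSeries.C (7 * c₁ / 10) * (MvPowerSeries.X 0 * MvPowerSeries.X 1 ^ 6) +
      MvPowerSeries.C (8 * c₂ / 10) * (MvPowerSeries.X 0 * MvPowerSeries.X 1 ^ 7)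
  have hC (c : ℂ) (n : ℕ) [n.AtLeastTwo] : MvPowerSeries.C (σ := Fin 2) (c / OfNat.ofNat n) *
      OfNat.ofNat n = MvPowerSeries.C c := by
    rw [← map_ofNat (MvPowerSeries.C (σ := Fin 2) (R := ℂ)) n, ← map_mul,
      div_mul_cancel₀ _ (OfNat.ofNat_ne_zero n)]
  have hcoe (n : ℕ) [n.AtLeastTwo] : ((OfNat.ofNat n : MvPolynomial (Fin 2) ℂ) :
      MvPowerSeries (Fin 2) ℂ) = OfNat.ofNat n := map_ofNat coeToMvPowerSeries.ringHom n
  have hunit (n : ℕ) [n.AtLeastTwo] : IsUnit (OfNat.ofNat n : MvPowerSeries (Fin 2) ℂ) := by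
    rw [← map_ofNat (MvPowerSeries.C (σ := Fin 2) (R := ℂ)) n]
    exact (IsUnit.mk0 _ (OfNat.ofNat_ne_zero n)).map _
  have hx : ((pderiv 0 (X 0 ^ 3 + X 1 ^ 10 + C c₁ * X 0 * X 1 ^ 7 +
      C c₂ * X 0 * X 1 ^ 8) : MvPolynomial (Fin 2) ℂ) : MvPowerSeries (Fin 2) ℂ) =
      3 * (MvPowerSeries.X 0 ^ 2 + u) := by
    have h1 := hC c₁ 3
    have h2 := hC c₂ 3
    simp [pderiv_X, Derivation.leibniz_pow, hcoe]
    linear_combination -MvPowerSeries.X 1 ^ 7 * h1 - MvPowerSeries.X 1 ^ 8 * h2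
  have hy : ((pderiv 1 (X 0 ^ 3 + X 1 ^ 10 + C c₁ * X 0 * X 1 ^ 7 +
      C c₂ * X 0 * X 1 ^ 8) : MvPolynomial (Fin 2) ℂ) : MvPowerSeries (Fin 2) ℂ) =
      10 * (MvPowerSeries.X 1 ^ 9 + v) := by
    have h1 := hC (7 * c₁) 10
    have h2 := hC (8 * c₂) 10
    rw [map_mul _ _ c₁, map_ofNat] at h1
    rw [map_mul _ _ c₂, map_ofNat] at h2
    simp [pderiv_X, Derivation.leibniz_pow, hcoe]
    linear_combination -MvPowerSeries.X 0 * MvPowerSeries.X 1 ^ 6 * h1 -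
      MvPowerSeries.X 0 * MvPowerSeries.X 1 ^ 7 * h2
  rw [hx, hy, Ideal.span_insert, Ideal.span_singleton_mul_left_unit (hunit 3),
    Ideal.span_singleton_mul_left_unit (hunit 10), ← Ideal.span_insert]
  refine MvPowerSeries.finrank_quotient_span_X_pow_add (w := ![10, 3]) (a := 2) (b := 9) ?_ ?_
  · refine add_mem (Ideal.mul_mem_left _ _ ?_) (Ideal.mul_mem_left _ _ ?_) <;>
    · rw [MvPowerSeries.X_pow_eq]
      exact MvPowerSeries.monomial_mem_weightIdeal _ _ (by simp [Finsupp.weight_single])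
  · refine add_mem (Ideal.mul_mem_left _ _ ?_) (Ideal.mul_mem_left _ _ ?_) <;>
    · rw [MvPowerSeries.X_pow_eq, MvPowerSeries.X, MvPowerSeries.monomial_mul_monomial]
      exact MvPowerSeries.monomial_mem_weightIdeal _ _ (by simp [Finsupp.weight_single])
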